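/- Let E be a real inner product space, G : E → ℝ convex and differentiable with ∇G Lipschitz with constant L > 0, h : E → ℝ convex, and f := G + h attain its minimum value f*. Assume f satisfies the KL inequality with constant μ > 0: for every x ∈ E and every subgradient s of f at x, f(x) - f* ≤ ‖s‖²/(2μ). Fix α ∈ E, a continuous linear self-adjoint B : E → E with ⟪d, Bd⟫ ≥ C1·‖d‖² for all d and ‖B‖ ≤ C3 (C3 > 0), such that Q(d) := ⟪∇G(α), d⟫ + (1/2)⟪d, Bd⟫ + h(α+d) is C2-strongly convex with C2 > 0 and C1 + C2 > 0. Let Δ be a global minimizer of Q, let s ∈ E be a subgradient of h at α + Δ with ∇G(α) + BΔ + s = 0, and let η ∈ [0,1] satisfy the Armijo condition f(α+ηΔ) ≤ f(α) + η·τ·Δ̂ for some τ ∈ (0,1), where Δ̂ := ⟪∇G(α), Δ⟫ + h(α+Δ) - h(α). Then, with C4 := 2·(L² + C3²)/(μ·(C1+C2)·τ), it holds that f(α + ηΔ) - f* ≤ ((1 - η + C4)/(1 + C4))·(f(α) - f*). -/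

import Mathlib

open RealInnerProductSpace

/-- `F` is `C`-strongly convex on a real inner product space. -/
def StrongConvex {E : Type*} [NormedAddCommGroup E] [InnerProductSpace ℝ E]
    (C : ℝ) (F : E → ℝ) : Prop :=
  ∀ x y : E, ∀ l : ℝ, l ∈ Set.Icc (0 : ℝ) 1 →
    F (l • x + (1 - l) • y) ≤ l * F x + (1 - l) * F y - C / 2 * (l * (1 - l)) * ‖x - y‖ ^ 2

/-- `s` is a subgradient of `F` at `x`. -/
def IsSubgradient {E : Type*} [NormedAddCommGroup E] [InnerProductSpace ℝ E]
    (F : E → ℝ) (s x : E) : Prop :=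
  ∀ y : E, F y ≥ F x + ⟪s, y - x⟫

theorem ConvexOn.isSubgradient_of_hasFDerivAt
    {E : Type*} [NormedAddCommGroup E] [InnerProductSpace ℝ E] {G : E → ℝ} {g x : E}
    (hG : ConvexOn ℝ Set.univ G)
    (hg : HasFDerivAt G (InnerProductSpace.toDualMap ℝ E g : E →L[ℝ] ℝ) x) :
    IsSubgradient G g x := by
  intro y
  have hline : ConvexOn ℝ Set.univ (G ∘ AffineMap.lineMap (k := ℝ) x y) := by
    simpa using hG.comp_affineMap (AffineMap.lineMap (k := ℝ) x y)
  have hderiv : HasDerivAt (G ∘ AffineMap.lineMap (k := ℝ) x y) ⟪g, y - x⟫ 0 := by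
    have h₀ : HasFDerivAt G (InnerProductSpace.toDualMap ℝ E g : E →L[ℝ] ℝ)
        (AffineMap.lineMap (k := ℝ) x y (0 : ℝ)) := by simpa using hg
    simpa using h₀.comp_hasDerivAt (0 : ℝ) AffineMap.hasDerivAt_lineMap
  have hslope := hline.le_slope_of_hasDerivAt (Set.mem_univ 0) (Set.mem_univ 1) one_pos hderiv
  simp [slope_def_field] at hslope
  linarith

theorem IsSubgradient.add
    {E : Type*} [NormedAddCommGroup E] [InnerProductSpace ℝ E] {F H : E → ℝ} {s t x : E}
    (hs : IsSubgradient F s x) (ht : IsSubgradient H t x) :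
    IsSubgradient (fun y => F y + H y) (s + t) x := by
  intro y
  have h₁ := hs y
  have h₂ := ht y
  simp only [inner_add_left]
  linarith

/-- Quadratic growth of a strongly convex function away from a global minimizer. -/
theorem StrongConvex.add_sq_le_of_forall_le
    {E : Type*} [NormedAddCommGroup E] [InnerProductSpace ℝ E] {C : ℝ} {F : E → ℝ} {z : E}
    (hF : StrongConvex C F) (hz : ∀ y, F z ≤ F y) (x : E) :
    F z + C / 2 * ‖x - z‖ ^ 2 ≤ F x := by
  by_contra! hlt
  set K := C / 2 * ‖x - z‖ ^ 2 with hK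
  have hzx := hz x
  have hKpos : 0 < K := by linarith
  set l := (K - (F x - F z)) / (2 * K) with hl
  have hl0 : 0 < l := div_pos (by linarith) (by linarith)
  have hl1 : l ≤ 1 := (div_le_one (by linarith)).2 (by linarith)
  have hlK : l * K = (K - (F x - F z)) / 2 := by rw [hl]; field_simp
  have h₁ := (hz _).trans (hF x z l ⟨hl0.le, hl1⟩)
  have h₂ : 0 ≤ l * (F x - F z - K + l * K) := by
    rw [hK]; linarith
  have h₃ := nonneg_of_mul_nonneg_right h₂ hl0
  linarith

/-- Per-iteration contraction (eq:qlinear) of the exact block-diagonal approximation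
method (Theorem 1 of the paper). -/
theorem per_iteration_contraction
    {E : Type*} [NormedAddCommGroup E] [InnerProductSpace ℝ E]
    (G h f : E → ℝ) (G' : E → E) (L μ : ℝ) (hL : 0 < L) (hμ : 0 < μ)
    (hGconv : ConvexOn ℝ Set.univ G)
    (hGdiff : ∀ x : E, HasFDerivAt G ((InnerProductSpace.toDualMap ℝ E (G' x) : E →L[ℝ] ℝ)) x)
    (hGlip : ∀ x y : E, ‖G' x - G' y‖ ≤ L * ‖x - y‖)
    (hhconv : ConvexOn ℝ Set.univ h)
    (hf : ∀ x : E, f x = G x + h x)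
    (fstar : ℝ) (hfmin : ∀ x : E, fstar ≤ f x) (hfattain : ∃ x : E, f x = fstar)
    (hKL : ∀ (x s : E), IsSubgradient f s x → f x - fstar ≤ ‖s‖ ^ 2 / (2 * μ))
    (α : E) (B : E →L[ℝ] E)
    (hBsa : ∀ x y : E, ⟪B x, y⟫ = ⟪x, B y⟫)
    (C1 C2 C3 : ℝ) (hC2 : 0 < C2) (hC3 : 0 < C3) (hC12 : 0 < C1 + C2)
    (hB : ∀ d : E, C1 * ‖d‖ ^ 2 ≤ ⟪d, B d⟫) (hBnorm : ‖B‖ ≤ C3)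
    (Q : E → ℝ)
    (hQ : ∀ d : E, Q d = ⟪G' α, d⟫ + 1 / 2 * ⟪d, B d⟫ + h (α + d))
    (hQsc : StrongConvex C2 Q)
    (Δ : E) (hΔ : ∀ d : E, Q Δ ≤ Q d)
    (s : E) (hs : IsSubgradient h s (α + Δ))
    (hstat : G' α + B Δ + s = 0)
    (η τ : ℝ) (hη : η ∈ Set.Icc (0 : ℝ) 1) (hτ : τ ∈ Set.Ioo (0 : ℝ) 1)
    (Δhat : ℝ) (hΔhat : Δhat = ⟪G' α, Δ⟫ + h (α + Δ) - h α)
    (harmijo : f (α + η • Δ) ≤ f α + η * τ * Δhat)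
    (C4 : ℝ) (hC4 : C4 = 2 * (L ^ 2 + C3 ^ 2) / (μ * (C1 + C2) * τ)) :
    f (α + η • Δ) - fstar ≤ (1 - η + C4) / (1 + C4) * (f α - fstar) := by
  obtain ⟨hη0, hη1⟩ := hη
  have hτ0 := hτ.1
  have hf_eq : f = fun y => G y + h y := funext hf
  have hdescent : (C1 + C2) / 2 * ‖Δ‖ ^ 2 ≤ -Δhat := by
    have hgrowth := hQsc.add_sq_le_of_forall_le hΔ 0
    have hBΔ := hB Δ
    simp [hQ] at hgrowth
    linarith
  have hsub : IsSubgradient f (G' (α + Δ) + s) (α + Δ) :=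
    hf_eq ▸ (hGconv.isSubgradient_of_hasFDerivAt (hGdiff (α + Δ))).add hs
  have hnorm : ‖G' (α + Δ) + s‖ ≤ L * ‖Δ‖ + C3 * ‖Δ‖ := by
    have heq : G' (α + Δ) + s = (G' (α + Δ) - G' α) - B Δ := by
      rw [← sub_eq_zero, ← hstat]; abel
    have hlip := hGlip (α + Δ) α
    rw [add_sub_cancel_left] at hlip
    rw [heq]
    exact (norm_sub_le _ _).trans (add_le_add hlip (B.le_of_opNorm_le hBnorm Δ))
  have hnorm_sq : ‖G' (α + Δ) + s‖ ^ 2 ≤ 2 * (L ^ 2 + C3 ^ 2) * ‖Δ‖ ^ 2 := by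
    have hsq := pow_le_pow_left₀ (norm_nonneg _) hnorm 2
    nlinarith [sq_nonneg (L * ‖Δ‖ - C3 * ‖Δ‖)]
  have hC4_nonneg : 0 ≤ C4 := by rw [hC4]; positivity
  have hgap : f (α + Δ) - fstar ≤ C4 * (τ * -Δhat) := calc
    f (α + Δ) - fstar ≤ ‖G' (α + Δ) + s‖ ^ 2 / (2 * μ) := hKL _ _ hsub
    _ ≤ 2 * (L ^ 2 + C3 ^ 2) * ‖Δ‖ ^ 2 / (2 * μ) := by gcongr
    _ = C4 * (τ * ((C1 + C2) / 2 * ‖Δ‖ ^ 2)) := by rw [hC4]; field_simp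
    _ ≤ C4 * (τ * -Δhat) := by gcongr
  have hconv : f (α + η • Δ) ≤ (1 - η) * f α + η * f (α + Δ) := by
    have hfconv : ConvexOn ℝ Set.univ f := hf_eq ▸ hGconv.add hhconv
    have hcomb := hfconv.2 (Set.mem_univ α) (Set.mem_univ (α + Δ))
      (sub_nonneg.2 hη1) hη0 (sub_add_cancel 1 η)
    have hpt : (1 - η) • α + η • (α + Δ) = α + η • Δ := by module
    simpa only [hpt, smul_eq_mul] using hcomb
  have hdecrease : η * (f (α + Δ) - fstar) ≤ C4 * (f α - f (α + η • Δ)) := calc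
    η * (f (α + Δ) - fstar) ≤ η * (C4 * (τ * -Δhat)) := by gcongr
    _ = C4 * (-(η * τ * Δhat)) := by ring
    _ ≤ C4 * (f α - f (α + η • Δ)) := by gcongr; linarith
  rw [div_mul_eq_mul_div, le_div_iff₀ (by linarith)]
  linarith
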